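/- Let p be an odd prime and f, g ∈ F_p[X] two distinct monic quadratic polynomials such that f·g is not a square in F_p[X] (equivalently f ≠ g, both squarefree, sharing no common factor counted oddly). Then |Σ_{x ∈ F_p} χ(f(x)·g(x))| ≤ 3√p, where χ is the quadratic character of F_p extended by χ(0) = 0. -/

import Mathlib

open WeierstrassCurve Polynomial

namespace HasseManin

/-- The quadratic twist by `l` of `y^2 = x^3 + a x^2 + b x + c`, in Weierstrass form. -/
def tw {K : Type*} [Field K] (a b c l : K) : WeierstrassCurve.Affine K :=
  { a₁ := 0, a₂ := a * l, a₃ := 0, a₄ := b * l ^ 2, a₆ := c * l ^ 3 }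

/-- `(u : v)` represents the untwisted `x`-coordinate of a point. -/
def xr {K : Type*} [Field K] {a b c l : K} : (tw a b c l).Point → K → K → Prop
  | .zero, u, v => u ≠ 0 ∧ v = 0
  | .some x _ _, u, v => x * v = l * u ∧ v ≠ 0

section
variable {K : Type*} [Field K] {a b c l t : K}

lemma tw_nonsing (h2 : (2 : K) ≠ 0) {x y : K} (hy : y ≠ 0)
    (h : y ^ 2 = x ^ 3 + a * l * x ^ 2 + b * l ^ 2 * x + c * l ^ 3) :
    (tw a b c l).Nonsingular x y := by
  rw [WeierstrassCurve.Affine.nonsingular_iff', WeierstrassCurve.Affine.equation_iff]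
  simp only [tw]
  refine ⟨by linear_combination h, Or.inr ?_⟩
  simpa using ⟨h2, hy⟩

lemma tw_eq {x y : K} (h : (tw a b c l).Nonsingular x y) :
    y ^ 2 = x ^ 3 + a * l * x ^ 2 + b * l ^ 2 * x + c * l ^ 3 := by
  have := ((tw a b c l).nonsingular_iff' x y).1 h |>.1
  rw [WeierstrassCurve.Affine.equation_iff] at this
  simp only [tw] at this
  linear_combination this

lemma tw_negY (x y : K) : (tw a b c l).negY x y = -y := by simp [tw, Affine.negY]

lemma tw_addX (x y m : K) : (tw a b c l).addX x y m = m ^ 2 - a * l - x - y := by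
  simp [tw, Affine.addX]

lemma xr_neg (P : (tw a b c l).Point) (u v : K) : xr (-P) u v ↔ xr P u v := by
  cases P <;> rfl

variable [DecidableEq K]

lemma xr_add {x1 y1 x2 y2 : K} (h1 : (tw a b c l).Nonsingular x1 y1)
    (h2 : (tw a b c l).Nonsingular x2 y2) (hx : x1 ≠ x2) (u v : K) :
    xr (.some _ _ h1 + .some _ _ h2) u v ↔
      (((y1 - y2) / (x1 - x2)) ^ 2 - a * l - x1 - x2) * v = l * u ∧ v ≠ 0 := by
  rw [Affine.Point.add_some (fun h => hx h.1)]
  simp only [xr, tw_addX, Affine.slope_of_X_ne hx]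

lemma xr_dbl {x y : K} (hc : (2 : K) ≠ 0) (h : (tw a b c l).Nonsingular x y) (hy : y ≠ 0) (u v : K) :
    xr (.some _ _ h + .some _ _ h) u v ↔
      (((3 * x ^ 2 + 2 * (a * l) * x + b * l ^ 2) / (2 * y)) ^ 2 - a * l - x - x) * v = l * u
        ∧ v ≠ 0 := by
  have hy' : y ≠ (tw a b c l).negY x y := by
    rw [tw_negY]
    intro e
    have : 2 * y = 0 := by linear_combination e
    exact hy ((mul_eq_zero.1 this).resolve_left hc)
  rw [Affine.Point.add_self_of_Y_ne hy']
  simp only [xr, tw_addX, Affine.slope_of_Y_ne rfl hy']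
  rw [tw_negY]
  simp only [tw]
  rw [show y - -y = 2 * y by ring, zero_mul, sub_zero]

lemma cross_dbl (hc : (2 : K) ≠ 0) (hl : l ≠ 0) (hlt : l = t ^ 3 + a * t ^ 2 + b * t + c)
    (hQ : (tw a b c l).Nonsingular (l * t) (l ^ 2)) (u1 v1 v : K)
    (h1 : xr (Affine.Point.some _ _ hQ + .some _ _ hQ) u1 v1) :
    v1 * ((t * v * t - b * v) ^ 2 - 4 * c * v * (t * v + t * v + a * v))
      = u1 * (2 * ((t * v * t + b * v) * (t * v + t * v) + 2 * a * (t * v) * t * v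
        + 2 * c * v ^ 2)) := by
  have hl2 : l ^ 2 ≠ 0 := pow_ne_zero 2 hl
  rw [xr_dbl hc hQ hl2] at h1
  obtain ⟨e1, -⟩ := h1
  have e3 : (3 * (l * t) ^ 2 + 2 * (a * l) * (l * t) + b * l ^ 2) / (2 * l ^ 2)
      = (3 * t ^ 2 + 2 * a * t + b) / 2 := by
    field_simp
  rw [e3] at e1
  have e4 : ((3 * t ^ 2 + 2 * a * t + b) ^ 2 - 4 * (a * l) - 8 * (l * t)) * v1 = 4 * l * u1 := by
    have : (4 : K) ≠ 0 := by
      rw [show (4 : K) = 2 * 2 by norm_num]; exact mul_ne_zero hc hc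
    field_simp at e1
    linear_combination e1
  linear_combination v ^ 2 * e4 + (4 * u1 + 4 * a * v1 + 8 * t * v1) * v ^ 2 * hlt

lemma cross (hc : (2 : K) ≠ 0) (hl : l ≠ 0) (hlt : l = t ^ 3 + a * t ^ 2 + b * t + c)
    (hQ : (tw a b c l).Nonsingular (l * t) (l ^ 2))
    (P : (tw a b c l).Point) (u v u1 v1 u2 v2 : K) (h : xr P u v)
    (h1 : xr (P + .some _ _ hQ) u1 v1) (h2 : xr (P - .some _ _ hQ) u2 v2) :
    v1 * v2 * (2 * ((u * t + b * v) * (u + t * v) + 2 * a * u * t * v + 2 * c * v ^ 2))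
        = (u1 * v2 + u2 * v1) * (u - t * v) ^ 2 ∧
    v1 * v2 * ((u * t - b * v) ^ 2 - 4 * c * v * (u + t * v + a * v))
        = u1 * u2 * (u - t * v) ^ 2 ∧
    (u1 * v2 + u2 * v1) * ((u * t - b * v) ^ 2 - 4 * c * v * (u + t * v + a * v))
        = u1 * u2 * (2 * ((u * t + b * v) * (u + t * v) + 2 * a * u * t * v + 2 * c * v ^ 2)) := by
  have hl2 : l ^ 2 ≠ 0 := pow_ne_zero 2 hl
  rcases P with _ | ⟨x, y, hP⟩
  · change xr (0 + _) _ _ at h1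
    change xr (0 - _) _ _ at h2
    rw [zero_add] at h1
    rw [zero_sub, Affine.Point.neg_some] at h2
    simp only [xr] at h h1 h2
    obtain ⟨hu, rfl⟩ := h
    obtain ⟨e1, -⟩ := h1
    obtain ⟨e2, -⟩ := h2
    have e1 : u1 = t * v1 := mul_left_cancel₀ hl (by linear_combination -e1)
    have e2 : u2 = t * v2 := mul_left_cancel₀ hl (by linear_combination -e2)
    subst e1 e2
    refine ⟨by ring, by ring, by ring⟩
  · have hE := tw_eq hP
    obtain ⟨e, hv⟩ := h
    by_cases hx : x = l * t
    · have e0 : u = t * v := mul_left_cancel₀ hl (by rw [hx] at e; linear_combination -e)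
      subst e0
      rcases Affine.Point.X_eq_iff (h₁ := hP) (h₂ := hQ) |>.1 hx with hy | hy
      · rw [hy, sub_self] at h2
        rw [hy] at h1
        have h2 : u2 ≠ 0 ∧ v2 = 0 := h2
        obtain ⟨hu2, rfl⟩ := h2
        have := cross_dbl hc hl hlt hQ u1 v1 v h1
        refine ⟨by ring, by ring, ?_⟩
        linear_combination u2 * this
      · rw [hy, neg_add_cancel] at h1
        rw [hy, ← neg_add', xr_neg] at h2
        have h1 : u1 ≠ 0 ∧ v1 = 0 := h1
        obtain ⟨hu1, rfl⟩ := h1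
        have := cross_dbl hc hl hlt hQ u2 v2 v h2
        refine ⟨by ring, by ring, ?_⟩
        linear_combination u1 * this
    · rw [xr_add hP hQ hx] at h1
      rw [sub_eq_add_neg, Affine.Point.neg_some, xr_add hP _ hx, tw_negY] at h2
      obtain ⟨e1, hv1⟩ := h1
      obtain ⟨e2, hv2⟩ := h2
      obtain ⟨z, rfl⟩ : ∃ z, x = l * z := ⟨x / l, by field_simp⟩
      obtain ⟨w, rfl⟩ : ∃ w, y = l ^ 2 * w := ⟨y / l ^ 2, by field_simp⟩
      have e0 : u = z * v := mul_left_cancel₀ hl (by linear_combination -e)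
      subst e0
      have hzt : z - t ≠ 0 := fun h => hx (by rw [sub_eq_zero.1 h])
      have hE' : l * w ^ 2 = z ^ 3 + a * z ^ 2 + b * z + c :=
        mul_left_cancel₀ (pow_ne_zero 3 hl) (by linear_combination hE)
      have hm1 : (l ^ 2 * w - l ^ 2) / (l * z - l * t) = l * (w - 1) / (z - t) := by
        rw [← mul_sub, div_eq_div_iff (mul_ne_zero hl hzt) hzt]; ring
      have hm2 : (l ^ 2 * w - -l ^ 2) / (l * z - l * t) = l * (w + 1) / (z - t) := by
        rw [← mul_sub, div_eq_div_iff (mul_ne_zero hl hzt) hzt]; ring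
      rw [hm1] at e1
      rw [hm2] at e2
      obtain ⟨x1, rfl⟩ : ∃ x1, u1 = x1 * v1 := ⟨u1 / v1, by field_simp⟩
      obtain ⟨x2, rfl⟩ : ∃ x2, u2 = x2 * v2 := ⟨u2 / v2, by field_simp⟩
      have f1 : (z - t) ^ 2 * x1 = l * (w - 1) ^ 2 - (a + z + t) * (z - t) ^ 2 := by
        apply mul_left_cancel₀ (mul_ne_zero hl hv1)
        field_simp at e1
        linear_combination -l * v1 * e1
      have f2 : (z - t) ^ 2 * x2 = l * (w + 1) ^ 2 - (a + z + t) * (z - t) ^ 2 := by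
        apply mul_left_cancel₀ (mul_ne_zero hl hv2)
        field_simp at e2
        linear_combination -l * v2 * e2
      have g1 : (z - t) ^ 2 * (x1 + x2) =
          2 * ((z * t + b) * (z + t) + 2 * a * z * t + 2 * c) := by
        linear_combination f1 + f2 + 2 * hE' + 2 * hlt
      have g2 : (z - t) ^ 2 * (x1 * x2) = (z * t - b) ^ 2 - 4 * c * (z + t + a) := by
        apply mul_left_cancel₀ (pow_ne_zero 2 hzt)
        have : (z - t) ^ 2 * ((z - t) ^ 2 * (x1 * x2)) =
          (l * (w - 1) ^ 2 - (a + z + t) * (z - t) ^ 2) *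
          (l * (w + 1) ^ 2 - (a + z + t) * (z - t) ^ 2) := by
          rw [← f1, ← f2]; ring
        rw [this]
        have : (l * (w - 1) ^ 2 - (a + z + t) * (z - t) ^ 2) *
          (l * (w + 1) ^ 2 - (a + z + t) * (z - t) ^ 2) = (l * w ^ 2 - l) ^ 2
           - 2 * (l * w ^ 2 + l) * (a + z + t) * (z - t) ^ 2
           + (a + z + t) ^ 2 * (z - t) ^ 4 := by ring
        rw [this, hE', hlt]
        ring
      refine ⟨?_, ?_, ?_⟩
      · linear_combination -v ^ 2 * v1 * v2 * g1
      · linear_combination -v ^ 2 * v1 * v2 * g2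
      · linear_combination v ^ 2 * v1 * v2 * (-(x1 + x2) * g2 + x1 * x2 * g1)
end
lemma prop_unit {R : Type*} [CommRing R] {A0 A1 A2 G0 G1 G2 : R}
    (h01 : A0 * G1 = A1 * G0) (h02 : A0 * G2 = A2 * G0) (h12 : A1 * G2 = A2 * G1)
    (hA : ∃ r0 r1 r2, r0 * A0 + r1 * A1 + r2 * A2 = 1)
    (hG : ∃ r0 r1 r2, r0 * G0 + r1 * G1 + r2 * G2 = 1) :
    ∃ k : R, IsUnit k ∧ A0 = k * G0 ∧ A1 = k * G1 ∧ A2 = k * G2 := by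
  obtain ⟨r0, r1, r2, hr⟩ := hA
  obtain ⟨s0, s1, s2, hs⟩ := hG
  refine ⟨s0 * A0 + s1 * A1 + s2 * A2, ?_, ?_, ?_, ?_⟩
  · refine IsUnit.of_mul_eq_one (r0 * G0 + r1 * G1 + r2 * G2) ?_
    have e : (s0 * A0 + s1 * A1 + s2 * A2) * (r0 * G0 + r1 * G1 + r2 * G2) =
      (s0 * G0 + s1 * G1 + s2 * G2) * (r0 * A0 + r1 * A1 + r2 * A2) := by
      linear_combination (r1 * s0 - r0 * s1) * h01 + (r2 * s0 - r0 * s2) * h02 + (r2 * s1 - r1 * s2) * h12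
    rw [e, hr, hs, one_mul]
  · linear_combination -A0 * hs + s1 * h01 + s2 * h02
  · linear_combination -A1 * hs - s0 * h01 + s2 * h12
  · linear_combination -A2 * hs - s0 * h02 - s1 * h12

lemma bezout3 {R : Type*} [CommRing R] (A0 A1 A2 : R)
    (h : ∀ M : Ideal R, M.IsPrime → A0 ∈ M → A1 ∈ M → A2 ∈ M → False) :
    ∃ r0 r1 r2, r0 * A0 + r1 * A1 + r2 * A2 = 1 := by
  have : Ideal.span {A0, A1, A2} = ⊤ := by
    by_contra hne
    obtain ⟨M, hM, hle⟩ := Ideal.exists_le_maximal _ hne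
    exact h M hM.isPrime (hle (Ideal.subset_span (by simp))) (hle (Ideal.subset_span (by simp)))
      (hle (Ideal.subset_span (by simp)))
  have h1 : (1 : R) ∈ Ideal.span {A0, A1, A2} := by rw [this]; trivial
  rw [Ideal.mem_span_insert] at h1
  obtain ⟨r0, z, hz, e⟩ := h1
  rw [Ideal.mem_span_pair] at hz
  obtain ⟨r1, r2, e2⟩ := hz
  exact ⟨r0, r1, r2, by rw [e, ← e2]; ring⟩

lemma not_both {R : Type*} [CommRing R] {u v : R} (h : IsCoprime u v) (M : Ideal R)
    (hM : M.IsPrime) (hu : u ∈ M) (hv : v ∈ M) : False := by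
  obtain ⟨r, s, e⟩ := h
  exact hM.ne_top ((Ideal.eq_top_iff_one _).2 (e ▸ M.add_mem (M.mul_mem_left _ hu) (M.mul_mem_left _ hv)))

lemma prim_A {R : Type*} [CommRing R] {u1 v1 u2 v2 : R} (h1 : IsCoprime u1 v1)
    (h2 : IsCoprime u2 v2) :
    ∃ r0 r1 r2, r0 * (v1 * v2) + r1 * (u1 * v2 + u2 * v1) + r2 * (u1 * u2) = 1 := by
  apply bezout3
  intro M hM m0 m1 m2
  rcases hM.mem_or_mem m0 with hv | hv
  · rcases hM.mem_or_mem m2 with hu | hu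
    · exact not_both h1 M hM hu hv
    · have : u1 * v2 ∈ M := by
        have := M.sub_mem m1 (M.mul_mem_left u2 hv); simpa using this
      rcases hM.mem_or_mem this with h | h
      · exact not_both h1 M hM h hv
      · exact not_both h2 M hM hu h
  · rcases hM.mem_or_mem m2 with hu | hu
    · have : u2 * v1 ∈ M := by
        have := M.sub_mem m1 (M.mul_mem_left u1 hv); simpa using this
      rcases hM.mem_or_mem this with h | h
      · exact not_both h2 M hM h hv
      · exact not_both h1 M hM hu h
    · exact not_both h2 M hM hu hv

lemma prim_G {R : Type*} [CommRing R] {a b c t u v : R} (hc : IsUnit (2 : R))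
    (huv : IsCoprime u v)
    (hsep : IsCoprime (t ^ 3 + a * t ^ 2 + b * t + c) (3 * t ^ 2 + 2 * a * t + b)) :
    ∃ r0 r1 r2, r0 * (u - t * v) ^ 2 +
      r1 * (2 * ((u * t + b * v) * (u + t * v) + 2 * a * u * t * v + 2 * c * v ^ 2)) +
      r2 * ((u * t - b * v) ^ 2 - 4 * c * v * (u + t * v + a * v)) = 1 := by
  apply bezout3
  intro M hM m0 m1 m2
  have h0 := hM.mem_of_pow_mem _ m0
  have hv : v ∉ M := fun hv => not_both huv M hM
    (by have := M.add_mem h0 (M.mul_mem_left t hv); simpa using this) hv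
  have h2 : (2 : R) ∉ M := fun h => hM.ne_top (M.eq_top_of_isUnit_mem h hc)
  have hf : t ^ 3 + a * t ^ 2 + b * t + c ∈ M := by
    have : 2 * 2 * v ^ 2 * (t ^ 3 + a * t ^ 2 + b * t + c) ∈ M := by
      have := M.sub_mem m1 (M.mul_mem_right
        (2 * (u * t + t * t * v + b * v + t * t * v + 2 * a * t * v)) h0)
      ring_nf at this ⊢
      exact this
    rcases hM.mem_or_mem this with h | h
    · rcases hM.mem_or_mem h with h | h
      · rcases hM.mem_or_mem h with h | h <;> exact absurd h h2
      · exact absurd (hM.mem_of_pow_mem _ h) hv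
    · exact h
  have hf' : 3 * t ^ 2 + 2 * a * t + b ∈ M := by
    have : v ^ 2 * (3 * t ^ 2 + 2 * a * t + b) ^ 2 ∈ M := by
      have := M.add_mem (M.sub_mem m2 (M.mul_mem_right (t * (u * t - b * v) + t * (t * t * v - b * v) - 4 * c * v) h0))
        (M.mul_mem_left (v ^ 2 * (8 * t + 4 * a)) hf)
      ring_nf at this ⊢
      exact this
    rcases hM.mem_or_mem this with h | h
    · exact absurd (hM.mem_of_pow_mem _ h) hv
    · exact hM.mem_of_pow_mem _ h
  exact not_both hsep M hM hf hf'

lemma good_of {F : Type*} [Field F] {u1 v1 u2 v2 : F[X]} {n : ℕ} (hu1 : u1 ≠ 0)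
    (hu2 : u2 ≠ 0) (h2 : (u1 * u2).natDegree = n + 1) (h1 : (u1 * v2 + u2 * v1).natDegree ≤ n)
    (h0 : (v1 * v2).natDegree ≤ n) : v1 = 0 ∨ v1.natDegree < u1.natDegree := by
  by_contra! hcon
  obtain ⟨hv1, hd⟩ := hcon
  rw [natDegree_mul hu1 hu2] at h2
  by_cases hv2 : v2 = 0
  · subst hv2
    rw [mul_zero, zero_add, natDegree_mul hu2 hv1] at h1
    omega
  · rw [natDegree_mul hv1 hv2] at h0
    have : (u1 * v2).natDegree < (u2 * v1).natDegree := by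
      rw [natDegree_mul hu1 hv2, natDegree_mul hu2 hv1]; omega
    rw [natDegree_add_eq_right_of_natDegree_lt this, natDegree_mul hu2 hv1] at h1
    omega

lemma key {F : Type*} [Field F] (hc : (2 : F) ≠ 0) {a b c : F}
    (hsep : IsCoprime (X ^ 3 + C a * X ^ 2 + C b * X + C c : F[X])
      (3 * X ^ 2 + 2 * C a * X + C b))
    {u v u1 v1 u2 v2 : F[X]} (h : IsCoprime u v) (h1 : IsCoprime u1 v1) (h2 : IsCoprime u2 v2)
    (hg : v = 0 ∨ v.natDegree < u.natDegree)
    (h01 : v1 * v2 * (2 * ((u * X + C b * v) * (u + X * v) + 2 * C a * u * X * v + 2 * C c * v ^ 2))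
        = (u1 * v2 + u2 * v1) * (u - X * v) ^ 2)
    (h02 : v1 * v2 * ((u * X - C b * v) ^ 2 - 4 * C c * v * (u + X * v + C a * v))
        = u1 * u2 * (u - X * v) ^ 2)
    (h12 : (u1 * v2 + u2 * v1) * ((u * X - C b * v) ^ 2 - 4 * C c * v * (u + X * v + C a * v))
        = u1 * u2 * (2 * ((u * X + C b * v) * (u + X * v) + 2 * C a * u * X * v
          + 2 * C c * v ^ 2))) :
    u1.natDegree + u2.natDegree = 2 * u.natDegree + 2 ∧
    (v1 = 0 ∨ v1.natDegree < u1.natDegree) ∧ (v2 = 0 ∨ v2.natDegree < u2.natDegree) := by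
  have hc' : IsUnit (2 : F[X]) := by
    have : (2 : F[X]) = C 2 := (map_ofNat C 2).symm
    rw [this, isUnit_C]; exact hc.isUnit
  obtain ⟨k, hk, e0, e1, e2⟩ := prop_unit h01 h02 h12 (prim_A h1 h2) (prim_G hc' h hsep)
  obtain ⟨k, hk0, rfl⟩ := Polynomial.isUnit_iff.1 hk
  have hk0 := hk0.ne_zero
  have hu : u ≠ 0 := by
    rintro rfl
    rcases hg with rfl | hg
    · simp [isCoprime_zero_left] at h
    · simp at hg
  obtain ⟨d, hd⟩ : ∃ d, u.natDegree = d := ⟨_, rfl⟩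
  have hud : u.natDegree ≤ d := hd.le
  have hvd : v.natDegree ≤ d := by rcases hg with rfl | hg; simp; omega
  have hXv : (X * v).natDegree ≤ d := by
    rcases hg with rfl | hg
    · simp
    · refine natDegree_mul_le.trans ?_; rw [natDegree_X]; omega
  have hCm : ∀ (r : F) (q : F[X]) (n : ℕ), q.natDegree ≤ n → (C r * q).natDegree ≤ n :=
    fun r q n h => (natDegree_C_mul_le r q).trans h
  have hmul : ∀ (q r : F[X]) (m n N : ℕ), q.natDegree ≤ m → r.natDegree ≤ n → m + n ≤ N →
    (q * r).natDegree ≤ N := fun q r m n N h h' h'' => natDegree_mul_le.trans (by omega)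
  have hadd : ∀ (q r : F[X]) (n : ℕ), q.natDegree ≤ n → r.natDegree ≤ n →
    (q + r).natDegree ≤ n := fun q r n h h' => natDegree_add_le_of_degree_le h h'
  have hsub : ∀ (q r : F[X]) (n : ℕ), q.natDegree ≤ n → r.natDegree ≤ n →
    (q - r).natDegree ≤ n := fun q r n h h' => natDegree_sub_le_of_le h h' |>.trans (by simp)
  have huX : (u * X).natDegree = d + 1 := by rw [natDegree_mul_X hu, hd]
  have b0 : ((u - X * v) ^ 2).natDegree ≤ 2 * d + 1 := by
    rw [sq]; exact hmul _ _ d d _ (hsub _ _ _ hud hXv) (hsub _ _ _ hud hXv) (by omega)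
  have b1 : (2 * ((u * X + C b * v) * (u + X * v) + 2 * C a * u * X * v
      + 2 * C c * v ^ 2)).natDegree ≤ 2 * d + 1 := by
    have : (2 * ((u * X + C b * v) * (u + X * v) + 2 * C a * u * X * v + 2 * C c * v ^ 2))
      = C 2 * (((u * X + C b * v) * (u + X * v) + C (2 * a) * (u * (X * v)) + C (2 * c) * (v * v))) := by
      simp only [C_mul, C_ofNat]; ring
    rw [this]
    refine hCm _ _ _ (hadd _ _ _ (hadd _ _ _ ?_ ?_) ?_)
    · exact hmul _ _ (d + 1) d _ (hadd _ _ _ huX.le (hCm _ _ _ (by omega))) (hadd _ _ _ hud hXv)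
        (by omega)
    · exact hCm _ _ _ (hmul _ _ d d _ hud hXv (by omega))
    · exact hCm _ _ _ (hmul _ _ d d _ hvd hvd (by omega))
  have b2 : ((u * X - C b * v) ^ 2 - 4 * C c * v * (u + X * v + C a * v)).natDegree
      = 2 * d + 2 := by
    have h1 : (u * X - C b * v).natDegree = d + 1 := by
      rw [natDegree_sub_eq_left_of_natDegree_lt, huX]
      rw [huX]; exact Nat.lt_succ_of_le (hCm _ _ _ hvd)
    rw [natDegree_sub_eq_left_of_natDegree_lt, natDegree_pow, h1]; ring
    rw [natDegree_pow, h1]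
    have : 4 * C c * v * (u + X * v + C a * v) = C (4 * c) * (v * (u + X * v + C a * v)) := by
      simp only [C_mul, C_ofNat]; ring
    rw [this]
    have := hCm (4 * c) _ (2 * d) (hmul v (u + X * v + C a * v) d d _ hvd
      (hadd _ _ _ (hadd _ _ _ hud hXv) (hCm _ _ _ hvd)) (by omega))
    omega
  have a0 : (v1 * v2).natDegree ≤ 2 * d + 1 := by rw [e0]; exact hCm _ _ _ b0
  have a1 : (u1 * v2 + u2 * v1).natDegree ≤ 2 * d + 1 := by rw [e1]; exact hCm _ _ _ b1
  have a2 : (u1 * u2).natDegree = 2 * d + 2 := by rw [e2, natDegree_C_mul hk0, b2]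
  have hne : u1 * u2 ≠ 0 := by intro h; rw [h] at a2; simp at a2
  have hu1 := left_ne_zero_of_mul hne
  have hu2 := right_ne_zero_of_mul hne
  refine ⟨by rw [hd, ← a2, natDegree_mul hu1 hu2], good_of hu1 hu2 a2 a1 a0,
    good_of hu2 hu1 (n := 2 * d + 1) (by rw [mul_comm]; exact a2) (by rw [add_comm]; exact a1) (by rw [mul_comm]; exact a0)⟩

/-! ### Heights of points over the rational function field -/

noncomputable section

variable {F : Type*} [Field F]

/-- The generic cubic. -/
def cub (a b c : F) : F[X] := X ^ 3 + C a * X ^ 2 + C b * X + C c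

/-- The embedding of polynomials into rational functions. -/
abbrev emb : F[X] →+* RatFunc F := algebraMap F[X] (RatFunc F)

/-- The twisted curve over the rational function field. -/
abbrev E (a b c : F) : WeierstrassCurve.Affine (RatFunc F) :=
  tw (emb (C a)) (emb (C b)) (emb (C c)) (emb (cub a b c))

variable {a b c : F}

/-- numerator of the untwisted `x`-coordinate -/
def U : (E a b c).Point → F[X]
  | .zero => 1
  | .some x _ _ => (x / emb (cub a b c)).num

/-- denominator of the untwisted `x`-coordinate -/
def V : (E a b c).Point → F[X]
  | .zero => 0
  | .some x _ _ => (x / emb (cub a b c)).denom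

lemma cop (P : (E a b c).Point) : IsCoprime (U P) (V P) := by
  cases P with
  | zero => exact isCoprime_one_left
  | some x y h => exact RatFunc.isCoprime_num_denom _

lemma cub_monic : (cub a b c).Monic := by
  unfold cub; monicity!

lemma cub_natDegree : (cub a b c).natDegree = 3 := by
  unfold cub; compute_degree!

lemma emb_inj : Function.Injective (emb (F := F)) := RatFunc.algebraMap_injective F

lemma emb_cub_ne : emb (cub a b c) ≠ 0 := by
  rw [Ne, map_eq_zero_iff _ emb_inj]; exact cub_monic.ne_zero

lemma xr_UV (P : (E a b c).Point) : xr P (emb (U P)) (emb (V P)) := by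
  cases P with
  | zero => simp [xr, U, V]
  | some x y h =>
    have hd : emb (x / emb (cub a b c)).denom ≠ 0 := by
      rw [Ne, map_eq_zero_iff _ emb_inj]; exact RatFunc.denom_ne_zero _
    refine ⟨?_, hd⟩
    have := RatFunc.num_div_denom (x / emb (cub a b c))
    rw [div_eq_div_iff hd emb_cub_ne] at this
    simp only [U, V]
    rw [← this]; ring

/-- The point with `x = t`. -/
def Q (a b c : F) (hc : (2 : F) ≠ 0) : (E a b c).Point :=
  .some (emb (cub a b c) * emb X) (emb (cub a b c) ^ 2)
    (tw_nonsing (by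
      have : (2 : RatFunc F) = emb (C 2) := by rw [map_ofNat C 2]; exact (map_ofNat emb 2).symm
      rw [this, Ne, map_eq_zero_iff _ emb_inj]; exact (_root_.map_ne_zero C).2 hc) (pow_ne_zero 2 emb_cub_ne) (by
      have : emb (cub a b c) =
        emb X ^ 3 + emb (C a) * emb X ^ 2 + emb (C b) * emb X + emb (C c) := by
          simp only [← map_mul, ← map_add, ← map_pow, cub]
      linear_combination emb (cub a b c) ^ 3 * this))

/-- the degree of a point -/
def dg (P : (E a b c).Point) : ℕ := (U P).natDegree

/-- a point reducing to the origin at infinity -/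
def Good (P : (E a b c).Point) : Prop := V P = 0 ∨ (V P).natDegree < (U P).natDegree

open Classical in
lemma para (hc : (2 : F) ≠ 0) (hsep : (cub a b c).Separable) (P : (E a b c).Point) (hP : Good P) :
    dg (P + Q a b c hc) + dg (P - Q a b c hc) = 2 * dg P + 2 ∧
      Good (P + Q a b c hc) ∧ Good (P - Q a b c hc) := by
  have hsep' : IsCoprime (X ^ 3 + C a * X ^ 2 + C b * X + C c : F[X])
      (3 * X ^ 2 + 2 * C a * X + C b) := by
    have := hsep
    rw [separable_def] at this
    convert! this using 1
    simp only [cub, derivative_add, derivative_X_pow, derivative_mul, derivative_C, derivative_X]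
    push_cast
    simp only [map_ofNat]
    ring
  have hlt : emb (cub a b c) =
        emb X ^ 3 + emb (C a) * emb X ^ 2 + emb (C b) * emb X + emb (C c) := by
          simp only [← map_mul, ← map_add, ← map_pow, cub]
  have hc' : (2 : RatFunc F) ≠ 0 := by
      have : (2 : RatFunc F) = emb (C 2) := by rw [map_ofNat C 2]; exact (map_ofNat emb 2).symm
      rw [this, Ne, map_eq_zero_iff _ emb_inj]; exact (_root_.map_ne_zero C).2 hc
  obtain ⟨h1, h2, h3⟩ := cross hc' emb_cub_ne hlt _ P _ _ _ _ _ _ (xr_UV P)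
    (xr_UV (P + Q a b c hc)) (xr_UV (P - Q a b c hc))
  have e2 : (2 : RatFunc F) = emb 2 := (map_ofNat emb 2).symm
  have e4 : (4 : RatFunc F) = emb 4 := (map_ofNat emb 4).symm
  rw [e2] at h1 h3
  rw [e4] at h2 h3
  simp only [← map_mul, ← map_add, ← map_pow, ← map_sub] at h1 h2 h3
  exact key hc hsep' (cop P) (cop _) (cop _) hP (emb_inj h1) (emb_inj h2) (emb_inj h3)

end

noncomputable section
variable {p : ℕ} [Fact p.Prime] {a b c : ZMod p}

lemma two_ne (hp : p ≠ 2) : (2 : ZMod p) ≠ 0 := by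
  have : ringChar (ZMod p) ≠ 2 := by rwa [ZMod.ringChar_zmod_n]
  exact Ring.two_ne_zero this

lemma two_half (hp : p ≠ 2) : 2 * (p / 2) + 1 = p := by
  have := (Fact.out : p.Prime).eq_two_or_odd
  omega

lemma frob_pow (q : (ZMod p)[X]) : q ^ p = q.comp (X ^ p) := by
  rw [← expand_eq_comp_X_pow, ZMod.expand_card]

/-- The Frobenius point. -/
def P0 (a b c : ZMod p) (hp : p ≠ 2) : (E a b c).Point :=
  .some (emb (cub a b c) * emb (X ^ p)) (emb (cub a b c) ^ 2 * emb (cub a b c ^ (p / 2)))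
    (tw_nonsing (by
      have : (2 : RatFunc (ZMod p)) = emb (C 2) := by rw [map_ofNat C 2]; exact (map_ofNat emb 2).symm
      rw [this, Ne, map_eq_zero_iff _ emb_inj]; exact (_root_.map_ne_zero C).2 (two_ne hp))
      (mul_ne_zero (pow_ne_zero 2 emb_cub_ne) (by
        rw [map_pow]; exact pow_ne_zero _ emb_cub_ne)) (by
      have h : cub a b c ^ p = cub a b c * (cub a b c ^ (p / 2)) ^ 2 := by
        rw [← pow_mul, ← pow_succ', mul_comm (p / 2), two_half hp]
      have : cub a b c * (cub a b c ^ (p / 2)) ^ 2 =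
        (X ^ p) ^ 3 + C a * (X ^ p) ^ 2 + C b * X ^ p + C c := by
          rw [← h, frob_pow]; simp [cub]
      have := congrArg emb this
      simp only [map_mul, map_add] at this
      rw [map_pow emb (cub a b c ^ (p / 2)), map_pow emb (X ^ p), map_pow emb (X ^ p)] at this
      linear_combination emb (cub a b c) ^ 3 * this))

lemma dg_P0 (hp : p ≠ 2) : dg (P0 a b c hp) = p := by
  simp only [dg, U, P0]
  rw [mul_div_cancel_left₀ _ emb_cub_ne, RatFunc.num_algebraMap, natDegree_X_pow]

lemma good_P0 (hp : p ≠ 2) : Good (P0 a b c hp) := by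
  right
  change (V (P0 a b c hp)).natDegree < dg (P0 a b c hp)
  rw [dg_P0]
  simp only [V, P0]
  rw [mul_div_cancel_left₀ _ emb_cub_ne, RatFunc.denom_algebraMap, natDegree_one]
  exact (Fact.out : p.Prime).pos

/-- numerator of the `x`-coordinate of `P0 ± Q` -/
def num' (a b c e : ZMod p) : (ZMod p)[X] :=
  cub a b c * (cub a b c ^ (p / 2) - C e) ^ 2 - (C a + X ^ p + X) * (X ^ p - X) ^ 2

lemma num'_natDegree (hp : p ≠ 2) (e : ZMod p) (he : e ^ 2 = 1) :
    (num' a b c e).natDegree ≤ 2 * p + 1 := by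
  have h2 := two_half hp
  have h1 : 2 ≤ p := (Fact.out : p.Prime).two_le
  have hC : C e ^ 2 = (1 : (ZMod p)[X]) := by rw [← C_pow, he, C_1]
  have h : cub a b c * (cub a b c ^ (p / 2)) ^ 2 = 
        (X ^ p) ^ 3 + C a * (X ^ p) ^ 2 + C b * X ^ p + C c := by
    rw [← pow_mul, ← pow_succ', mul_comm (p / 2), two_half hp, frob_pow]; simp [cub]
  have e1 : num' a b c e = C b * X ^ p + C c - C (2 * e) * cub a b c ^ (p / 2 + 1) + cub a b c
      + X ^ (2 * p + 1) + C (2 * a) * X ^ (p + 1) - C a * X ^ 2 + X ^ (p + 2) - X ^ 3 := by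
    simp only [num', C_mul, map_ofNat]
    linear_combination h + cub a b c * hC
  have hcub : (cub a b c ^ (p / 2 + 1)).natDegree ≤ 2 * p + 1 := by
    rw [natDegree_pow, cub_natDegree]; omega
  have hcub1 : (cub a b c).natDegree ≤ 2 * p + 1 := by
    rw [cub_natDegree]; omega
  rw [e1]
  have hX : ∀ n, n ≤ 2 * p + 1 → ((X : (ZMod p)[X]) ^ n).natDegree ≤ 2 * p + 1 :=
    fun n hn => by rw [natDegree_X_pow]; exact hn
  have hCm : ∀ (r : ZMod p) (q : (ZMod p)[X]) (n : ℕ), q.natDegree ≤ n → (C r * q).natDegree ≤ n :=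
    fun r q n h => (natDegree_C_mul_le r q).trans h
  have hadd : ∀ (q r : (ZMod p)[X]) (n : ℕ), q.natDegree ≤ n → r.natDegree ≤ n →
    (q + r).natDegree ≤ n := fun q r n h h' => natDegree_add_le_of_degree_le h h'
  have hsub : ∀ (q r : (ZMod p)[X]) (n : ℕ), q.natDegree ≤ n → r.natDegree ≤ n →
    (q - r).natDegree ≤ n := fun q r n h h' => natDegree_sub_le_of_le h h' |>.trans (by simp)
  exact hsub _ _ _ (hadd _ _ _ (hsub _ _ _ (hadd _ _ _ (hadd _ _ _ (hadd _ _ _ (hsub _ _ _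
    (hadd _ _ _ (hCm _ _ _ (hX _ (by omega))) (by simp)) (hCm _ _ _ hcub)) hcub1)
    (hX _ (by omega))) (hCm _ _ _ (hX _ (by omega)))) (hCm _ _ _ (hX _ (by omega))))
    (hX _ (by omega))) (hX _ (by omega))

/-- the common factor -/
def ww (a b c : ZMod p) (s : ℤ) : (ZMod p)[X] :=
  ∏ α : ZMod p, (X - C α) ^ (1 + s * quadraticChar (ZMod p) ((cub a b c).eval α)).toNat

lemma ww_natDegree (s : ℤ) (hs : s = 1 ∨ s = -1) :
    ((ww a b c s).natDegree : ℤ) = p + s * ∑ α : ZMod p, quadraticChar (ZMod p) ((cub a b c).eval α) := by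
  rw [ww, natDegree_prod_of_monic _ _ (fun α _ => (monic_X_sub_C α).pow _)]
  simp only [natDegree_pow, natDegree_X_sub_C, mul_one]
  push_cast
  have : ∀ α : ZMod p, ((1 + s * quadraticChar (ZMod p) ((cub a b c).eval α)).toNat : ℤ)
    = 1 + s * quadraticChar (ZMod p) ((cub a b c).eval α) := by
    intro α
    apply Int.toNat_of_nonneg
    by_cases h0 : (cub a b c).eval α = 0
    · simp [h0]
    · rcases quadraticChar_dichotomy h0 with h | h <;> rcases hs with rfl | rfl <;> rw [h] <;> norm_num
  simp only [this, Finset.sum_add_distrib, Finset.mul_sum]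
  simp [ZMod.card]

lemma ww_dvd_of (s : ℤ) (q : (ZMod p)[X])
    (h : ∀ α : ZMod p, (X - C α) ^ (1 + s * quadraticChar (ZMod p) ((cub a b c).eval α)).toNat ∣ q) :
    ww a b c s ∣ q := by
  apply Finset.prod_dvd_of_coprime
  · intro α _ β _ hne
    exact (pairwise_coprime_X_sub_C (s := id) Function.injective_id hne).pow
  · intro α _; exact h α

lemma ww_dvd_den (s : ℤ) (hs : s = 1 ∨ s = -1) : ww a b c s ∣ (X ^ p - X) ^ 2 := by
  apply ww_dvd_of
  intro α
  have h1 : (X - C α) ∣ (X ^ p - X : (ZMod p)[X]) := by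
    rw [dvd_iff_isRoot]; simp [ZMod.pow_card]
  refine (pow_dvd_pow _ ?_).trans (pow_dvd_pow_of_dvd h1 2)
  by_cases h0 : (cub a b c).eval α = 0
  · simp [h0]
  · rcases quadraticChar_dichotomy h0 with h | h <;> rcases hs with rfl | rfl <;> rw [h] <;> norm_num

lemma ww_dvd_num (hp : p ≠ 2) (s : ℤ) (hs : s = 1 ∨ s = -1) : ww a b c s ∣ num' a b c (s : ZMod p) := by
  refine dvd_sub ?_ ((ww_dvd_den s hs).mul_left _)
  apply ww_dvd_of
  intro α
  have hr : ringChar (ZMod p) ≠ 2 := by rwa [ZMod.ringChar_zmod_n]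
  by_cases h0 : (cub a b c).eval α = 0
  · simp only [h0]
    simp only [MulChar.map_zero, mul_zero, add_zero, Int.toNat_one, pow_one]
    exact (dvd_iff_isRoot.2 h0).mul_right _
  · have hq := quadraticChar_eq_pow_of_char_ne_two' hr ((cub a b c).eval α)
    rw [ZMod.card] at hq
    by_cases h : quadraticChar (ZMod p) ((cub a b c).eval α) = s
    · have h2 : (1 + s * s).toNat = 2 := by rcases hs with rfl | rfl <;> rfl
      rw [h, h2]
      refine (pow_dvd_pow_of_dvd ?_ 2).mul_left _
      rw [dvd_iff_isRoot]
      simp [← hq, h]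
    · have h2 : (1 + s * quadraticChar (ZMod p) ((cub a b c).eval α)).toNat = 0 := by
        rcases quadraticChar_dichotomy h0 with h' | h' <;> rcases hs with rfl | rfl <;>
          rw [h'] at h ⊢ <;> simp_all
      rw [h2, pow_zero]; exact one_dvd _

lemma dg_le (hp : p ≠ 2) (s : ℤ) (hs : s = 1 ∨ s = -1) (P : (E a b c).Point)
    (h : ∀ u v, xr P u v → u * emb ((X ^ p - X) ^ 2) = v * emb (num' a b c (s : ZMod p))) :
    (dg P : ℤ) ≤ p + 1 - s * ∑ α : ZMod p, quadraticChar (ZMod p) ((cub a b c).eval α) := by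
  have h1 := h _ _ (xr_UV P)
  rw [← map_mul, ← map_mul] at h1
  have h1 := emb_inj h1
  obtain ⟨D, hD⟩ := ww_dvd_den (a := a) (b := b) (c := c) s hs
  obtain ⟨N, hN⟩ := ww_dvd_num (a := a) (b := b) (c := c) hp s hs
  have hwd := ww_natDegree (a := a) (b := b) (c := c) s hs
  have hw0 : ww a b c s ≠ 0 := (monic_prod_of_monic _ _ fun α _ => (monic_X_sub_C α).pow _).ne_zero
  have hnd := num'_natDegree (a := a) (b := b) (c := c) hp (s : ZMod p) (by
    rcases hs with rfl | rfl <;> simp)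
  rw [hD, hN] at h1
  have h2 : U P * D = V P * N := mul_left_cancel₀ hw0 (by linear_combination h1)
  have h3 : U P ∣ N := (cop P).dvd_of_dvd_mul_left (Dvd.intro _ h2)
  by_cases hN0 : N = 0
  · subst hN0
    rw [mul_zero] at h2
    have hD0 : D ≠ 0 := by
      rintro rfl
      rw [mul_zero] at hD
      have : (X ^ p - X : (ZMod p)[X]).natDegree = p :=
        FiniteField.X_pow_card_sub_X_natDegree_eq _ (Fact.out : p.Prime).one_lt
      rw [pow_eq_zero_iff two_ne_zero] at hD
      rw [hD, natDegree_zero] at this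
      exact (Fact.out : p.Prime).ne_zero this.symm
    have hU : U P = 0 := (mul_eq_zero.1 h2).resolve_right hD0
    have : ((ww a b c s).natDegree : ℤ) ≤ 2 * p := by
      have hdvd := natDegree_le_of_dvd (ww_dvd_den (a := a) (b := b) (c := c) s hs) (by
        rw [hD]; exact mul_ne_zero hw0 hD0)
      rw [natDegree_pow, FiniteField.X_pow_card_sub_X_natDegree_eq _ (Fact.out : p.Prime).one_lt] at hdvd
      exact_mod_cast hdvd
    rw [dg, hU, natDegree_zero]
    push_cast
    linarith
  · have h4 := natDegree_le_of_dvd h3 hN0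
    rw [hN, natDegree_mul hw0 hN0] at hnd
    have : (dg P : ℤ) ≤ N.natDegree := by exact_mod_cast h4
    have : ((ww a b c s).natDegree : ℤ) + N.natDegree ≤ 2 * p + 1 := by exact_mod_cast hnd
    linarith

open Classical in
lemma frob_pm (hp : p ≠ 2) (s : ℤ) (hs : s = 1 ∨ s = -1) :
    (dg (P0 a b c hp + s • Q a b c (two_ne hp)) : ℤ) ≤
      p + 1 - s * ∑ α : ZMod p, quadraticChar (ZMod p) ((cub a b c).eval α) := by
  have hne0 : (X ^ p - X : (ZMod p)[X]) ≠ 0 :=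
    FiniteField.X_pow_card_sub_X_ne_zero _ (Fact.out : p.Prime).one_lt
  have hne : emb (X ^ p : (ZMod p)[X]) - emb X ≠ 0 := by
    rw [← map_sub, Ne, map_eq_zero_iff _ emb_inj]; exact hne0
  have hx : emb (cub a b c) * emb (X ^ p) ≠ emb (cub a b c) * emb X := fun h =>
    hne (sub_eq_zero.2 (mul_left_cancel₀ emb_cub_ne h))
  have hxr : ∀ u v, xr (P0 a b c hp + s • Q a b c (two_ne hp)) u v ↔ 
      ((emb (cub a b c) * (emb (cub a b c ^ (p / 2)) - (s : RatFunc (ZMod p))) / (emb (X ^ p) - emb X)) ^ 2 -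
        emb (C a) * emb (cub a b c) - emb (cub a b c) * emb (X ^ p) - emb (cub a b c) * emb X) * v
        = emb (cub a b c) * u ∧ v ≠ 0 := by
    intro u v
    have hl := emb_cub_ne (a := a) (b := b) (c := c)
    rcases hs with rfl | rfl
    · rw [one_zsmul, P0, Q, xr_add _ _ hx, ← mul_sub]
      have : (emb (cub a b c) ^ 2 * emb (cub a b c ^ (p / 2)) - emb (cub a b c) ^ 2) /
          (emb (cub a b c) * (emb (X ^ p) - emb X)) = 
          emb (cub a b c) * (emb (cub a b c ^ (p / 2)) - ((1 : ℤ) : RatFunc (ZMod p))) / (emb (X ^ p) - emb X) := by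
        rw [div_eq_div_iff (mul_ne_zero hl hne) hne]; push_cast; ring
      rw [this]
    · rw [neg_zsmul, one_zsmul, P0, Q, Affine.Point.neg_some, xr_add _ _ hx, ← mul_sub, tw_negY]
      have : (emb (cub a b c) ^ 2 * emb (cub a b c ^ (p / 2)) - -emb (cub a b c) ^ 2) /
          (emb (cub a b c) * (emb (X ^ p) - emb X)) = 
          emb (cub a b c) * (emb (cub a b c ^ (p / 2)) - ((-1 : ℤ) : RatFunc (ZMod p))) / (emb (X ^ p) - emb X) := by
        rw [div_eq_div_iff (mul_ne_zero hl hne) hne]; push_cast; ring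
      rw [this]
  refine dg_le hp s hs _ ?_
  · intro u v huv
    obtain ⟨h1, -⟩ := (hxr u v).1 huv
    have hs' : emb (C (s : ZMod p)) = (s : RatFunc (ZMod p)) := by
      rw [map_intCast (C : ZMod p →+* (ZMod p)[X]) s]; exact map_intCast emb s
    simp only [num']
    rw [map_pow emb (X ^ p - X), map_sub emb (_ * _), map_mul, map_mul,
      map_pow emb (cub a b c ^ (p / 2) - _), map_sub emb (cub a b c ^ (p / 2)), hs', map_add,
      map_add, map_pow emb (X ^ p - X), map_sub emb (X ^ p)]
    clear huv hxr hx
    generalize emb ((X : (ZMod p)[X]) ^ p) = Z at *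
    generalize emb (cub a b c ^ (p / 2)) = Y at *
    have hl := emb_cub_ne (a := a) (b := b) (c := c)
    generalize emb (cub a b c) = l at *
    generalize (s : RatFunc (ZMod p)) = s at *
    generalize emb (X : (ZMod p)[X]) = t at *
    generalize emb (C a : (ZMod p)[X]) = A at *
    apply mul_left_cancel₀ hl
    field_simp at h1
    linear_combination -l * h1

open Classical in
theorem hasse (hp : p ≠ 2) (hsep : (cub a b c).Separable) :
    (∑ α : ZMod p, quadraticChar (ZMod p) ((cub a b c).eval α)) ^ 2 ≤ 4 * (p : ℤ) + 1 := by
  set S := ∑ α : ZMod p, quadraticChar (ZMod p) ((cub a b c).eval α) with hS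
  set R := Q a b c (two_ne hp) with hR
  set P := P0 a b c hp with hP
  have hpara := para (two_ne hp) hsep
  have g0 : Good P := good_P0 hp
  have hd0 : dg P = p := dg_P0 hp
  have hp1 := frob_pm (a := a) (b := b) (c := c) hp 1 (Or.inl rfl)
  have hm1 := frob_pm (a := a) (b := b) (c := c) hp (-1) (Or.inr rfl)
  rw [← hS, ← hP, ← hR, one_zsmul] at hp1
  rw [← hS, ← hP, ← hR, neg_zsmul, one_zsmul, ← sub_eq_add_neg] at hm1
  obtain ⟨q1, q2, q3⟩ := hpara P g0
  rw [← hR, hd0] at q1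
  have hd1 : (dg (P + R) : ℤ) = p + 1 - S := by
    have : (dg (P + R) : ℤ) + dg (P - R) = 2 * p + 2 := by exact_mod_cast q1
    linarith
  have main : ∀ n : ℤ, (Good (P + n • R) ∧ Good (P + (n + 1) • R)) ∧
      (dg (P + n • R) : ℤ) = n ^ 2 - S * n + p ∧
      (dg (P + (n + 1) • R) : ℤ) = (n + 1) ^ 2 - S * (n + 1) + p := by
    intro n
    induction n using Int.induction_on with
    | zero =>
      simp only [zero_zsmul, zero_add, one_zsmul]
      rw [add_zero]
      refine ⟨⟨g0, q2⟩, by rw [hd0]; ring, by rw [hd1]; ring⟩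
    | succ i ih =>
      obtain ⟨⟨g1, g2⟩, d1, d2⟩ := ih
      obtain ⟨r1, r2, r3⟩ := hpara _ g2
      have e1 : P + ((i : ℤ) + 1) • R + R = P + ((i : ℤ) + 1 + 1) • R := by
        rw [add_zsmul R ((i : ℤ) + 1) 1, one_zsmul, add_assoc]
      have e2 : P + ((i : ℤ) + 1) • R - R = P + (i : ℤ) • R := by
        rw [add_zsmul, one_zsmul, ← add_assoc, add_sub_cancel_right]
      rw [← hR, e1] at r1 r2
      rw [e2] at r1
      refine ⟨⟨g2, r2⟩, d2, ?_⟩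
      zify at r1
      rw [d1, d2] at r1
      linear_combination r1
    | pred i ih =>
      obtain ⟨⟨g1, g2⟩, d1, d2⟩ := ih
      obtain ⟨r1, r2, r3⟩ := hpara _ g1
      have e1 : P + (-(i : ℤ)) • R + R = P + (-(i : ℤ) + 1) • R := by
        rw [add_zsmul R _ 1, one_zsmul, add_assoc]
      have e2 : P + (-(i : ℤ)) • R - R = P + (-(i : ℤ) - 1) • R := by
        rw [sub_zsmul, one_zsmul, add_sub_assoc, sub_eq_add_neg]
      rw [← hR, e2] at r1 r3
      rw [e1] at r1
      rw [sub_add_cancel]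
      refine ⟨⟨r3, g1⟩, ?_, d1⟩
      zify at r1
      rw [d1, d2] at r1
      linear_combination r1
  have hnn : ∀ n : ℤ, 0 ≤ n ^ 2 - S * n + p := fun n => by
    rw [← (main n).2.1]; positivity
  rcases Int.even_or_odd' S with ⟨k, hk | hk⟩
  · have := hnn k
    rw [hk] at this ⊢
    nlinarith
  · have := hnn k
    rw [hk] at this ⊢
    nlinarith

end

/-! ### Singular cubics -/

lemma sing {p : ℕ} [Fact p.Prime] {a b c : ZMod p} (hp : p ≠ 2) (h : ¬ (cub a b c).Separable) :
    |∑ α : ZMod p, quadraticChar (ZMod p) ((cub a b c).eval α)| ≤ 1 := by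
  have hr : ringChar (ZMod p) ≠ 2 := by rwa [ZMod.ringChar_zmod_n]
  rw [PerfectField.separable_iff_squarefree, Squarefree] at h
  push Not at h
  obtain ⟨x, ⟨y, hxy⟩, hx⟩ := h
  have hne : (cub a b c) ≠ 0 := cub_monic.ne_zero
  have hdeg : (cub a b c).natDegree = 3 := cub_natDegree
  have hx0 : x ≠ 0 := by rintro rfl; simp at hxy; exact hne hxy
  have hy0 : y ≠ 0 := by rintro rfl; simp at hxy; exact hne hxy
  rw [hxy, natDegree_mul (mul_ne_zero hx0 hx0) hy0, natDegree_mul hx0 hx0] at hdeg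
  have hxd : x.natDegree ≠ 0 := fun h0 => hx (isUnit_iff_degree_eq_zero.2 (by
    rw [degree_eq_natDegree hx0, h0]; rfl))
  have hx1 : x.natDegree = 1 := by omega
  have hy1 : y.natDegree = 1 := by omega
  obtain ⟨k, hk, m, rfl⟩ := natDegree_eq_one.1 hx1
  obtain ⟨l, hl, n, rfl⟩ := natDegree_eq_one.1 hy1
  have hterm : ∀ α : ZMod p, quadraticChar (ZMod p) ((cub a b c).eval α) =
      quadraticChar (ZMod p) (l * α + n) -
        if α = -m / k then quadraticChar (ZMod p) (l * (-m / k) + n) else 0 := by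
    intro α
    rw [hxy]
    simp only [eval_mul, eval_add, eval_C, eval_X, map_mul]
    split_ifs with hα
    · have : k * α + m = 0 := by rw [hα]; field_simp; ring
      rw [this, hα]; simp
    · have : k * α + m ≠ 0 := by
        intro h0
        apply hα
        field_simp
        linear_combination h0
      rw [← sq, quadraticChar_sq_one this]; ring
  simp only [hterm, Finset.sum_sub_distrib]
  have hsum : ∑ α : ZMod p, quadraticChar (ZMod p) (l * α + n) = 0 := by
    rw [← quadraticChar_sum_zero hr]
    exact Function.Bijective.sum_comp (Finite.injective_iff_bijective.1
      (fun u v huv => by simpa [hl] using huv)) (fun z => quadraticChar (ZMod p) z)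
  rw [hsum, Finset.sum_ite_eq' Finset.univ]
  simp only [Finset.mem_univ, if_true, zero_sub, abs_neg]
  by_cases h0 : l * (-m / k) + n = 0
  · rw [h0]; simp
  · rcases quadraticChar_dichotomy h0 with h | h <;> rw [h] <;> norm_num

lemma hasse' {p : ℕ} [Fact p.Prime] {a b c : ZMod p} (hp : p ≠ 2) :
    (∑ α : ZMod p, quadraticChar (ZMod p) ((cub a b c).eval α)) ^ 2 ≤ 4 * (p : ℤ) + 1 := by
  by_cases h : (cub a b c).Separable
  · exact hasse hp h
  · have := sing hp h
    rw [← sq_le_one_iff_abs_le_one] at this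
    have : (0 : ℤ) ≤ p := by positivity
    linarith

/-! ### From quartics to cubics -/

lemma card_aff {p : ℕ} [Fact p.Prime] (hp : p ≠ 2) {k : ZMod p} (hk : k ≠ 0) (m n : ZMod p) :
    (∑ x : ZMod p, if (k * x + m) ^ 2 = n then (1 : ℤ) else 0) = quadraticChar (ZMod p) n + 1 := by
  have hr : ringChar (ZMod p) ≠ 2 := by rwa [ZMod.ringChar_zmod_n]
  rw [← quadraticChar_card_sqrts hr n]
  have := Function.Bijective.sum_comp (Finite.injective_iff_bijective.1
      (fun u v huv => by simpa [hk] using huv : Function.Injective (fun x : ZMod p => k * x + m)))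
      (fun z => if z ^ 2 = n then (1 : ℤ) else 0)
  rw [this, Finset.sum_boole]
  congr 2
  ext x
  simp

lemma quartic {p : ℕ} [Fact p.Prime] (hp : p ≠ 2) (h a b c : ZMod p)
    (hns : ¬ (b = h * a ∧ 4 * c = a ^ 2)) :
    ∑ x : ZMod p, quadraticChar (ZMod p) ((x ^ 2 + h * x) ^ 2 + a * x ^ 2 + b * x + c) =
      (∑ z : ZMod p, quadraticChar (ZMod p)
        ((cub (a + h ^ 2) (2 * b * h - 4 * c) (b ^ 2 - 4 * a * c)).eval z)) - 1 := by
  have h2 := two_ne hp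
  have h4 : (4 : ZMod p) ≠ 0 := by
    rw [show (4 : ZMod p) = 2 * 2 by norm_num]; exact mul_ne_zero h2 h2
  have hx : ∀ x : ZMod p, (∑ z : ZMod p,
      if 4 * (z + a) * x ^ 2 + 4 * (b + h * z) * x + 4 * c - z ^ 2 = 0 then (1 : ℤ) else 0)
      = quadraticChar (ZMod p) ((x ^ 2 + h * x) ^ 2 + a * x ^ 2 + b * x + c) + 1 := by
    intro x
    have e : quadraticChar (ZMod p) ((x ^ 2 + h * x) ^ 2 + a * x ^ 2 + b * x + c) =
      quadraticChar (ZMod p) (2 ^ 2 * ((x ^ 2 + h * x) ^ 2 + a * x ^ 2 + b * x + c)) := by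
      rw [map_mul, quadraticChar_sq_one' h2, one_mul]
    rw [e, ← card_aff hp one_ne_zero (-2 * (x ^ 2 + h * x))]
    refine Finset.sum_congr rfl fun z _ => if_congr ?_ rfl rfl
    constructor
    · intro H; linear_combination -H
    · intro H; linear_combination -H
  have hz : ∀ z : ZMod p, (∑ x : ZMod p,
      if 4 * (z + a) * x ^ 2 + 4 * (b + h * z) * x + 4 * c - z ^ 2 = 0 then (1 : ℤ) else 0)
      = quadraticChar (ZMod p)
        ((cub (a + h ^ 2) (2 * b * h - 4 * c) (b ^ 2 - 4 * a * c)).eval z) + 1 -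
        if z = -a then 1 else 0 := by
    intro z
    have hcub : (cub (a + h ^ 2) (2 * b * h - 4 * c) (b ^ 2 - 4 * a * c)).eval z =
        (b + h * z) ^ 2 - (z + a) * (4 * c - z ^ 2) := by
      simp only [cub, eval_add, eval_mul, eval_pow, eval_X, eval_C]; ring
    rw [hcub]
    split_ifs with hza
    · subst hza
      by_cases hb : b = h * a
      · have hc : 4 * c - a ^ 2 ≠ 0 := fun h0 => hns ⟨hb, by linear_combination h0⟩
        subst hb
        have : ∀ x : ZMod p, ¬ (4 * (-a + a) * x ^ 2 + 4 * (h * a + h * -a) * x + 4 * c - (-a) ^ 2 = 0) := by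
          intro x H; exact hc (by linear_combination H)
        rw [Finset.sum_eq_zero (fun x _ => if_neg (this x))]
        have e : (h * a + h * -a) ^ 2 - (-a + a) * (4 * c - (-a) ^ 2) = 0 := by ring
        rw [e]; simp
      · have hb' : b + h * -a ≠ 0 := fun h0 => hb (by linear_combination h0)
        have : (b + h * -a) ^ 2 - (-a + a) * (4 * c - (-a) ^ 2) = (b + h * -a) ^ 2 := by ring
        rw [this, quadraticChar_sq_one' hb']
        rw [Finset.sum_eq_single_of_mem ((a ^ 2 - 4 * c) / (4 * (b + h * -a))) (Finset.mem_univ _)]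
        · have hx0 : (a ^ 2 - 4 * c) / (4 * (b + h * -a)) * (4 * (b + h * -a)) = a ^ 2 - 4 * c :=
            div_mul_cancel₀ _ (mul_ne_zero h4 hb')
          rw [if_pos (by linear_combination hx0)]; norm_num
        · intro x _ hne
          rw [if_neg]
          intro H
          apply hne
          rw [eq_div_iff (mul_ne_zero h4 hb')]
          linear_combination H
    · have hza' : z + a ≠ 0 := fun h0 => hza (by linear_combination h0)
      rw [sub_zero, ← card_aff hp (mul_ne_zero h2 hza') (b + h * z)]
      refine Finset.sum_congr rfl fun x _ => if_congr ?_ rfl rfl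
      constructor
      · intro H; linear_combination (z + a) * H
      · intro H
        apply mul_left_cancel₀ hza'
        linear_combination H
  have key := Finset.sum_comm (s := (Finset.univ : Finset (ZMod p))) (t := (Finset.univ : Finset (ZMod p)))
    (f := fun x z => if 4 * (z + a) * x ^ 2 + 4 * (b + h * z) * x + 4 * c - z ^ 2 = 0 then (1 : ℤ) else 0)
  simp only [hx, hz, Finset.sum_add_distrib, Finset.sum_sub_distrib] at key
  rw [Finset.sum_ite_eq' Finset.univ] at key
  simp only [Finset.mem_univ, if_true] at key
  linarith

end HasseManin

open HasseManin in
theorem stmt10 (p : ℕ) [Fact p.Prime] (hp : p ≠ 2)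
    (f g : Polynomial (ZMod p)) (hf : f.Monic) (hg : g.Monic)
    (hdf : f.natDegree = 2) (hdg : g.natDegree = 2) (hfg : f ≠ g)
    (hsq : ¬ IsSquare (f * g)) :
    |(∑ x : ZMod p, (quadraticChar (ZMod p) ((f * g).eval x) : ℝ))|
      ≤ 3 * Real.sqrt p := by
  have quad : ∀ q : Polynomial (ZMod p), q.Monic → q.natDegree = 2 →
      ∃ r s : ZMod p, q = X ^ 2 + C r * X + C s := by
    intro q hq hd
    refine ⟨q.coeff 1, q.coeff 0, ?_⟩
    conv_lhs => rw [hq.as_sum, hd]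
    rw [Finset.sum_range_succ, Finset.sum_range_one]
    ring
  obtain ⟨r, s, rfl⟩ := quad f hf hdf
  obtain ⟨r', s', rfl⟩ := quad g hg hdg
  have h2 := two_ne hp
  obtain ⟨h, hh⟩ : ∃ h, r + r' = 2 * h := ⟨(r + r') / 2, by field_simp⟩
  obtain ⟨a, ha⟩ : ∃ a, a = s + s' + r * r' - h ^ 2 := ⟨_, rfl⟩
  obtain ⟨b, hb⟩ : ∃ b, b = r * s' + r' * s := ⟨_, rfl⟩
  obtain ⟨c, hc⟩ : ∃ c, c = s * s' := ⟨_, rfl⟩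
  have hpoly : (X ^ 2 + C r * X + C s) * (X ^ 2 + C r' * X + C s') =
      (X ^ 2 + C h * X) ^ 2 + C a * X ^ 2 + C b * X + C c := by
    have hh' : C r + C r' = 2 * C h := by
      rw [← C_add, hh, C_mul]; rfl
    rw [ha, hb, hc]
    simp only [C_add, C_sub, C_mul, C_pow]
    linear_combination X ^ 3 * hh'
  have hns : ¬ (b = h * a ∧ 4 * c = a ^ 2) := by
    rintro ⟨e1, e2⟩
    apply hsq
    obtain ⟨d, hd⟩ : ∃ d, a = 2 * d := ⟨a / 2, by field_simp⟩
    have e3 : c = d ^ 2 := by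
      apply mul_left_cancel₀ (mul_ne_zero h2 h2)
      rw [hd] at e2
      linear_combination e2
    refine ⟨X ^ 2 + C h * X + C d, ?_⟩
    rw [hpoly, e1, hd, e3]
    simp only [C_mul, C_pow, show C (2 : ZMod p) = 2 from rfl]
    ring
  have hq := quartic hp h a b c hns
  have hS := hasse' (a := a + h ^ 2) (b := 2 * b * h - 4 * c) (c := b ^ 2 - 4 * a * c) hp
  set S := ∑ z : ZMod p, quadraticChar (ZMod p)
        ((cub (a + h ^ 2) (2 * b * h - 4 * c) (b ^ 2 - 4 * a * c)).eval z) with hSdef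
  have hsum : (∑ x : ZMod p, (quadraticChar (ZMod p)
      (((X ^ 2 + C r * X + C s) * (X ^ 2 + C r' * X + C s')).eval x) : ℝ)) = (S : ℝ) - 1 := by
    rw [hpoly]
    simp only [eval_add, eval_mul, eval_pow, eval_X, eval_C]
    exact_mod_cast hq
  rw [hsum]
  have hSR : (S : ℝ) ^ 2 ≤ 4 * p + 1 := by exact_mod_cast hS
  have hp3 : (3 : ℝ) ≤ p := by
    have h1 := (Fact.out : p.Prime).two_le
    have : 3 ≤ p := by omega
    exact_mod_cast this
  have hr := Real.sq_sqrt (show (0 : ℝ) ≤ p by linarith)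
  have hr0 := Real.sqrt_nonneg (p : ℝ)
  set w := Real.sqrt p
  have hw : (17 / 10 : ℝ) ≤ w := by
    by_contra! hcon
    nlinarith
  have : |(S : ℝ)| ≤ 3 * w - 1 := by
    rw [← Real.sqrt_sq_eq_abs]
    exact Real.sqrt_le_iff.2 ⟨by linarith, by nlinarith⟩
  rw [abs_le] at this ⊢
  constructor <;> linarith [this.1, this.2]
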